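/- arXiv:2002.12272 — 2 statements merged into one kernel-verified Lean document; each statement's English description precedes it below -/
import Mathlib

section
/- For every real p > 0, with μ = ∫₀¹ ∫₀¹ |x − y|^p dx dy, one has β^cube := ∫₀¹ ∫₀¹ ∫₀¹ |x − y|^p |x − z|^p dx dy dz − μ² = (2/(p+1)²) · [ (p² − 2) / ((2p+3)(p+2)²) + Γ(p+2)² / Γ(2p+4) ], where Γ is the Euler gamma function. -/
theorem integral_abs_sub_rpow {p x : ℝ} (hp : 0 < p) (h0 : 0 ≤ x) (h1 : x ≤ 1) :
    ∫ y in (0:ℝ)..1, |x - y| ^ p = (x ^ (p + 1) + (1 - x) ^ (p + 1)) / (p + 1) := by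
  have hc : Continuous fun y : ℝ => |x - y| ^ p :=
    (by fun_prop : Continuous fun y : ℝ => |x - y|).rpow_const fun _ => Or.inr hp.le
  have hz : (0:ℝ) ^ (p + 1) = 0 := Real.zero_rpow (by linarith)
  have hleft : ∫ y in (0:ℝ)..x, |x - y| ^ p = x ^ (p + 1) / (p + 1) := by
    have h : ∫ y in (0:ℝ)..x, |x - y| ^ p = ∫ y in (0:ℝ)..x, (x - y) ^ p := by
      refine intervalIntegral.integral_congr fun y hy => ?_
      rw [Set.uIcc_of_le h0] at hy
      simp only [abs_of_nonneg (sub_nonneg.2 hy.2)]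
    rw [h, intervalIntegral.integral_comp_sub_left (fun t => t ^ p) x,
      integral_rpow (Or.inl (by linarith))]
    simp [hz]
  have hright : ∫ y in x..1, |x - y| ^ p = (1 - x) ^ (p + 1) / (p + 1) := by
    have h : ∫ y in x..1, |x - y| ^ p = ∫ y in x..1, (y - x) ^ p := by
      refine intervalIntegral.integral_congr fun y hy => ?_
      rw [Set.uIcc_of_le h1] at hy
      simp only [abs_sub_comm x y, abs_of_nonneg (sub_nonneg.2 hy.1)]
    rw [h, intervalIntegral.integral_comp_sub_right (fun t => t ^ p) x,
      integral_rpow (Or.inl (by linarith))]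
    simp [hz]
  rw [← intervalIntegral.integral_add_adjacent_intervals (hc.intervalIntegrable 0 x)
    (hc.intervalIntegrable x 1), hleft, hright, add_div]

theorem integral_rpow_mul_one_sub_rpow {a b : ℝ} (ha : 0 < a) (hb : 0 < b) :
    ∫ x in (0:ℝ)..1, x ^ (a - 1) * (1 - x) ^ (b - 1) =
      Real.Gamma a * Real.Gamma b / Real.Gamma (a + b) := by
  have h : Complex.betaIntegral a b =
      ((∫ x in (0:ℝ)..1, x ^ (a - 1) * (1 - x) ^ (b - 1) : ℝ) : ℂ) := by
    rw [Complex.betaIntegral, ← intervalIntegral.integral_ofReal]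
    refine intervalIntegral.integral_congr fun x hx => ?_
    rw [Set.uIcc_of_le zero_le_one] at hx
    rw [Complex.ofReal_mul, Complex.ofReal_cpow hx.1, Complex.ofReal_cpow (sub_nonneg.2 hx.2)]
    push_cast
    rfl
  change _ = ProbabilityTheory.beta a b
  rw [ProbabilityTheory.beta_eq_betaIntegralReal a b ha hb, h, Complex.ofReal_re]

theorem integral_one_sub_rpow {q : ℝ} (hq : 0 < q) :
    ∫ x in (0:ℝ)..1, (1 - x) ^ q = 1 / (q + 1) := by
  rw [intervalIntegral.integral_comp_sub_left (fun t => t ^ q) 1,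
    integral_rpow (Or.inl (by linarith))]
  simp [Real.zero_rpow (by linarith : q + 1 ≠ 0)]

theorem integral_zero_one_rpow {q : ℝ} (hq : 0 < q) :
    ∫ x in (0:ℝ)..1, x ^ q = 1 / (q + 1) := by
  rw [integral_rpow (Or.inl (by linarith))]
  simp [Real.zero_rpow (by linarith : q + 1 ≠ 0)]

theorem integral_rpow_add_one_sub_rpow {q : ℝ} (hq : 0 < q) :
    ∫ x in (0:ℝ)..1, (x ^ q + (1 - x) ^ q) = 2 / (q + 1) := by
  have hc : Continuous fun x : ℝ => x ^ q := Real.continuous_rpow_const hq.le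
  have hc' : Continuous fun x : ℝ => (1 - x) ^ q :=
    hc.comp (by fun_prop : Continuous (1 - · : ℝ → ℝ))
  rw [intervalIntegral.integral_add (hc.intervalIntegrable 0 1) (hc'.intervalIntegrable 0 1),
    integral_one_sub_rpow hq, integral_zero_one_rpow hq]
  ring

theorem integral_rpow_add_one_sub_rpow_sq {q : ℝ} (hq : 0 < q) :
    ∫ x in (0:ℝ)..1, (x ^ q + (1 - x) ^ q) ^ 2 =
      2 / (2 * q + 1) + 2 * (Real.Gamma (q + 1) ^ 2 / Real.Gamma (2 * q + 2)) := by
  have hc {r : ℝ} (hr : 0 < r) : Continuous fun x : ℝ => x ^ r := Real.continuous_rpow_const hr.le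
  have hc' {r : ℝ} (hr : 0 < r) : Continuous fun x : ℝ => (1 - x) ^ r :=
    (hc hr).comp (by fun_prop : Continuous (1 - · : ℝ → ℝ))
  have h2 : 0 < 2 * q := by linarith
  have hbeta := integral_rpow_mul_one_sub_rpow (a := q + 1) (b := q + 1) (by linarith) (by linarith)
  simp only [add_sub_cancel_right] at hbeta
  have hsq {t : ℝ} (ht : 0 ≤ t) : (t ^ q) ^ 2 = t ^ (2 * q) := by
    rw [← Real.rpow_mul_natCast ht, Nat.cast_ofNat, mul_comm]
  have h : ∫ x in (0:ℝ)..1, (x ^ q + (1 - x) ^ q) ^ 2 =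
      ∫ x in (0:ℝ)..1, (x ^ (2 * q) + (1 - x) ^ (2 * q) + 2 * (x ^ q * (1 - x) ^ q)) := by
    refine intervalIntegral.integral_congr fun x hx => ?_
    rw [Set.uIcc_of_le zero_le_one] at hx
    simp only [← hsq hx.1, ← hsq (sub_nonneg.2 hx.2)]
    ring
  have hsum : Continuous fun x : ℝ => x ^ (2 * q) + (1 - x) ^ (2 * q) := (hc h2).add (hc' h2)
  have hprod : Continuous fun x : ℝ => 2 * (x ^ q * (1 - x) ^ q) :=
    continuous_const.mul ((hc hq).mul (hc' hq))
  rw [h, intervalIntegral.integral_add (hsum.intervalIntegrable 0 1)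
      (hprod.intervalIntegrable 0 1),
    integral_rpow_add_one_sub_rpow h2, intervalIntegral.integral_const_mul, hbeta]
  ring_nf


/-- For every real `p > 0`, with `μ = ∫₀¹ ∫₀¹ |x - y|^p dx dy`, the triangular correlation
coefficient on the hypercube is
`β^cube = ∫₀¹∫₀¹∫₀¹ |x-y|^p |x-z|^p dx dy dz - μ²
        = (2/(p+1)²) [ (p²-2)/((2p+3)(p+2)²) + Γ(p+2)²/Γ(2p+4) ]`,
where `Γ` is the Euler gamma function. -/
theorem stmt_6 (p : ℝ) (hp : 0 < p) :
    (∫ x in (0:ℝ)..1, ∫ y in (0:ℝ)..1, ∫ z in (0:ℝ)..1, |x - y| ^ p * |x - z| ^ p) -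
      (∫ x in (0:ℝ)..1, ∫ y in (0:ℝ)..1, |x - y| ^ p) ^ 2
    = (2 / (p + 1) ^ 2) *
        ((p ^ 2 - 2) / ((2 * p + 3) * (p + 2) ^ 2)
          + Real.Gamma (p + 2) ^ 2 / Real.Gamma (2 * p + 4)) := by
  have hq : 0 < p + 1 := by linarith
  have hmean : ∫ x in (0:ℝ)..1, ∫ y in (0:ℝ)..1, |x - y| ^ p = 2 / (p + 2) / (p + 1) := by
    have h : ∫ x in (0:ℝ)..1, ∫ y in (0:ℝ)..1, |x - y| ^ p =
        ∫ x in (0:ℝ)..1, (x ^ (p + 1) + (1 - x) ^ (p + 1)) / (p + 1) := by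
      refine intervalIntegral.integral_congr fun x hx => ?_
      rw [Set.uIcc_of_le zero_le_one] at hx
      exact integral_abs_sub_rpow hp hx.1 hx.2
    rw [h, intervalIntegral.integral_div, integral_rpow_add_one_sub_rpow hq]
    ring_nf
  have htriple : ∫ x in (0:ℝ)..1, ∫ y in (0:ℝ)..1, ∫ z in (0:ℝ)..1, |x - y| ^ p * |x - z| ^ p =
      (2 / (2 * p + 3) + 2 * (Real.Gamma (p + 2) ^ 2 / Real.Gamma (2 * p + 4))) / (p + 1) ^ 2 := by
    have h : ∫ x in (0:ℝ)..1, ∫ y in (0:ℝ)..1, ∫ z in (0:ℝ)..1, |x - y| ^ p * |x - z| ^ p =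
        ∫ x in (0:ℝ)..1, (x ^ (p + 1) + (1 - x) ^ (p + 1)) ^ 2 / (p + 1) ^ 2 := by
      refine intervalIntegral.integral_congr fun x hx => ?_
      rw [Set.uIcc_of_le zero_le_one] at hx
      simp only [intervalIntegral.integral_const_mul, intervalIntegral.integral_mul_const,
        integral_abs_sub_rpow hp hx.1 hx.2]
      rw [← sq, div_pow]
    rw [h, intervalIntegral.integral_div, integral_rpow_add_one_sub_rpow_sq hq,
      show 2 * (p + 1) + 1 = 2 * p + 3 by ring, show p + 1 + 1 = p + 2 by ring,
      show 2 * (p + 1) + 2 = 2 * p + 4 by ring]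
  rw [hmean, htriple]
  generalize Real.Gamma (p + 2) ^ 2 / Real.Gamma (2 * p + 4) = B
  have h2 : p + 2 ≠ 0 := by linarith
  have h3 : 2 * p + 3 ≠ 0 := by linarith
  field_simp
  ring
end

section
/- Let M ≥ 3 and α, β, γ ∈ ℝ, and let Δ = Δ(M,α,β,γ) = (α−γ)I + (β−γ)J + γU as above. Then det Δ = λ₁ · λ₂^{M−1} · λ₃^{M(M−3)/2}, where λ₁ = α + 2(M−2)β + ((M−2)(M−3)/2)γ, λ₂ = α + (M−4)β − (M−3)γ, and λ₃ = α − 2β + γ. -/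
/-- Index set: ordered pairs `(i,j)` with `1 ≤ i < j ≤ M`. -/
abbrev PairIdx (M : ℕ) := {ij : Fin M × Fin M // ij.1 < ij.2}

/-- Adjacency matrix of the Johnson graph `J(M,2)`. -/
noncomputable def johnsonJ (M : ℕ) : Matrix (PairIdx M) (PairIdx M) ℝ :=
  Matrix.of fun a b =>
    if (({a.1.1, a.1.2} : Finset (Fin M)) ∩ {b.1.1, b.1.2}).card = 1 then 1 else 0

/-- The all-ones matrix `U`. -/
noncomputable def allOnes (M : ℕ) : Matrix (PairIdx M) (PairIdx M) ℝ :=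
  Matrix.of fun _ _ => 1

/-- The matrix `Δ(M,α,β,γ) = (α-γ) I + (β-γ) J + γ U`. -/
noncomputable def deltaMat (M : ℕ) (α β γ : ℝ) : Matrix (PairIdx M) (PairIdx M) ℝ :=
  (α - γ) • (1 : Matrix (PairIdx M) (PairIdx M) ℝ) + (β - γ) • johnsonJ M + γ • allOnes M

/-- The vertex-by-element incidence matrix of the pairs in `Fin M`. -/
noncomputable def pairIncidence (M : ℕ) : Matrix (PairIdx M) (Fin M) ℝ :=
  Matrix.of fun a k => if k ∈ ({a.1.1, a.1.2} : Finset (Fin M)) then 1 else 0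

lemma sum_pairIncidence (M : ℕ) (a : PairIdx M) : ∑ k, pairIncidence M a k = 2 := by
  simp [pairIncidence, -Finset.mem_insert, Finset.card_pair a.2.ne]

lemma pairIncidence_mul_transpose (M : ℕ) :
    pairIncidence M * (pairIncidence M).transpose = (2 : ℝ) • 1 + johnsonJ M := by
  ext a b
  have h1 : (pairIncidence M * (pairIncidence M).transpose) a b =
      ((({a.1.1, a.1.2} : Finset (Fin M)) ∩ {b.1.1, b.1.2}).card : ℝ) := by
    simp only [pairIncidence, Matrix.mul_apply, Matrix.transpose_apply, Matrix.of_apply,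
      ← ite_and, mul_ite, mul_one, mul_zero, Finset.sum_boole]
    congr 2
    ext k
    simp only [Finset.mem_filter, Finset.mem_univ, true_and, Finset.mem_inter]
    tauto
  rw [h1]
  obtain ⟨⟨i, j⟩, hij⟩ := a
  obtain ⟨⟨k, l⟩, hkl⟩ := b
  simp only at hij hkl
  by_cases hab : (i, j) = (k, l)
  · obtain ⟨rfl, rfl⟩ := Prod.mk.inj hab
    simp [johnsonJ, Finset.card_pair hij.ne]
  · have hlt : (({i, j} : Finset (Fin M)) ∩ {k, l}).card < 2 := by
      by_contra! h
      have e1 : ({i, j} : Finset (Fin M)) ∩ {k, l} = {i, j} :=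
        Finset.eq_of_subset_of_card_le Finset.inter_subset_left
          (by rwa [Finset.card_pair hij.ne])
      have hi : i ∈ ({k, l} : Finset (Fin M)) :=
        Finset.inter_eq_left.mp e1 (by simp)
      have hj : j ∈ ({k, l} : Finset (Fin M)) :=
        Finset.inter_eq_left.mp e1 (by simp)
      simp only [Finset.mem_insert, Finset.mem_singleton] at hi hj
      apply hab
      ext <;> simp only <;> omega
    generalize hc : (({i, j} : Finset (Fin M)) ∩ {k, l}).card = c at hlt
    simp only [johnsonJ, Matrix.add_apply, Matrix.smul_apply, Matrix.of_apply, hc]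
    rw [Matrix.one_apply_ne (by simpa using hab)]
    interval_cases c <;> simp

lemma transpose_mul_pairIncidence_apply_of_ne {M : ℕ} {k l : Fin M} (h : k ≠ l) :
    ((pairIncidence M).transpose * pairIncidence M) k l = 1 := by
  wlog hkl : k < l generalizing k l
  · have := this h.symm (lt_of_le_of_ne (not_lt.mp hkl) h.symm)
    rw [← this]
    simp [Matrix.mul_apply, mul_comm]
  rw [Matrix.mul_apply, Finset.sum_eq_single (⟨(k, l), hkl⟩ : PairIdx M)]
  · simp [pairIncidence]
  · rintro ⟨⟨i, j⟩, hij⟩ - hne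
    simp only at hij
    simp only [pairIncidence, Matrix.transpose_apply, Matrix.of_apply, Finset.mem_insert,
      Finset.mem_singleton, ne_eq, Subtype.mk.injEq, Prod.mk.injEq] at hne ⊢
    have hnot : ¬((k = i ∨ k = j) ∧ (l = i ∨ l = j)) := by omega
    by_cases hk : k = i ∨ k = j
    · have hl : ¬(l = i ∨ l = j) := fun hl => hnot ⟨hk, hl⟩
      rw [if_neg hl, mul_zero]
    · simp [hk]
  · simp

lemma transpose_mul_pairIncidence_apply_self {M : ℕ} (k : Fin M) :
    ((pairIncidence M).transpose * pairIncidence M) k k = ∑ a, pairIncidence M a k := by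
  rw [Matrix.mul_apply]
  refine Finset.sum_congr rfl fun a _ => ?_
  simp only [pairIncidence, Matrix.transpose_apply, Matrix.of_apply]
  split_ifs <;> simp

lemma sum_pairIncidence_right {M : ℕ} (k : Fin M) :
    ∑ a, pairIncidence M a k = (M : ℝ) - 1 := by
  have h1 : ∑ l, ((pairIncidence M).transpose * pairIncidence M) k l =
      2 * ∑ a, pairIncidence M a k := by
    simp only [Matrix.mul_apply, Matrix.transpose_apply]
    rw [Finset.sum_comm]
    simp only [← Finset.mul_sum, sum_pairIncidence, ← Finset.sum_mul]
    ring
  rw [← Finset.add_sum_erase _ _ (Finset.mem_univ k), transpose_mul_pairIncidence_apply_self, Finset.sum_congr rfl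
    (fun l hl => transpose_mul_pairIncidence_apply_of_ne (Finset.ne_of_mem_erase hl).symm)] at h1
  have hM : 1 ≤ M := k.pos
  simp [Nat.cast_sub hM] at h1
  linarith

lemma transpose_mul_pairIncidence (M : ℕ) :
    (pairIncidence M).transpose * pairIncidence M =
      ((M : ℝ) - 2) • 1 + Matrix.of fun _ _ => (1 : ℝ) := by
  ext k l
  rcases eq_or_ne k l with rfl | h
  · rw [transpose_mul_pairIncidence_apply_self, sum_pairIncidence_right]
    simp
    ring
  · rw [transpose_mul_pairIncidence_apply_of_ne h]
    simp [h]

lemma card_pairIdx_mul_two (M : ℕ) : Fintype.card (PairIdx M) * 2 = M * (M - 1) := by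
  have h := Finset.sum_comm (s := Finset.univ) (t := Finset.univ) (f := pairIncidence M)
  simp only [sum_pairIncidence, sum_pairIncidence_right, Finset.sum_const, Finset.card_univ,
    nsmul_eq_mul, Fintype.card_fin] at h
  rcases Nat.eq_zero_or_pos M with rfl | hM
  · simp
  · rw [← Nat.cast_pred hM] at h
    exact_mod_cast h

lemma Matrix.det_smul_one_add_mul_comm {m n R : Type*} [CommRing R] [Fintype m] [Fintype n]
    [DecidableEq m] [DecidableEq n] (A : Matrix m n R) (B : Matrix n m R) (c : R)
    (h : Fintype.card n ≤ Fintype.card m) :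
    (c • 1 + A * B).det =
      c ^ (Fintype.card m - Fintype.card n) * (c • 1 + B * A).det := by
  have := congrArg (Polynomial.eval c) (Matrix.charpoly_mul_comm_of_le (-A) B h)
  simpa [Matrix.eval_charpoly, Matrix.smul_one_eq_diagonal, Matrix.scalar_apply] using this

lemma Matrix.det_smul_one_add_smul_of_one {n R : Type*} [CommRing R] [Fintype n]
    [DecidableEq n] [Nonempty n] (a b : R) :
    (a • (1 : Matrix n n R) + b • Matrix.of fun _ _ => (1 : R)).det =
      a ^ (Fintype.card n - 1) * (a + Fintype.card n * b) := by
  have := Matrix.det_smul_one_add_mul_comm (Matrix.of fun (_ : n) (_ : Unit) => b)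
    (Matrix.of fun (_ : Unit) (_ : n) => (1 : R)) a (by simpa using Nat.one_le_iff_ne_zero.mpr Fintype.card_ne_zero)
  have e : (Matrix.of fun (_ : n) (_ : Unit) => b) * (Matrix.of fun (_ : Unit) (_ : n) => (1 : R))
      = b • Matrix.of fun _ _ => (1 : R) := by
    ext; simp [Matrix.mul_apply]
  rw [e] at this
  rw [this]
  simp [Matrix.mul_apply]

lemma pairIncidence_mul_ones_mul_transpose (M : ℕ) :
    pairIncidence M * (Matrix.of fun _ _ => (1 : ℝ) : Matrix (Fin M) (Fin M) ℝ) * (pairIncidence M).transpose =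
      (4 : ℝ) • allOnes M := by
  ext a b
  simp only [Matrix.mul_apply, Matrix.of_apply, mul_one, sum_pairIncidence,
    Matrix.transpose_apply, ← Finset.mul_sum, allOnes, Matrix.smul_apply]
  norm_num

lemma deltaMat_eq (M : ℕ) (α β γ : ℝ) :
    deltaMat M α β γ = (α - 2 * β + γ) • 1 + pairIncidence M *
      (((β - γ) • 1 + (γ / 4) • Matrix.of fun _ _ => (1 : ℝ) : Matrix (Fin M) (Fin M) ℝ) *
        (pairIncidence M).transpose) := by
  rw [← Matrix.mul_assoc, Matrix.mul_add, Matrix.add_mul, Matrix.mul_smul, Matrix.mul_smul,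
    Matrix.smul_mul, Matrix.smul_mul, Matrix.mul_one, pairIncidence_mul_transpose,
    pairIncidence_mul_ones_mul_transpose, deltaMat]
  module

/-- For `M ≥ 3`, `det Δ(M,α,β,γ) = λ₁ · λ₂^{M-1} · λ₃^{M(M-3)/2}` with
`λ₁ = α + 2(M-2)β + (M-2)(M-3)/2 γ`, `λ₂ = α + (M-4)β - (M-3)γ`, `λ₃ = α - 2β + γ`. -/
theorem stmt_11 (M : ℕ) (hM : 3 ≤ M) (α β γ : ℝ) :
    (deltaMat M α β γ).det
      = (α + 2 * ((M : ℝ) - 2) * β + ((M : ℝ) - 2) * ((M : ℝ) - 3) / 2 * γ)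
        * (α + ((M : ℝ) - 4) * β - ((M : ℝ) - 3) * γ) ^ (M - 1)
        * (α - 2 * β + γ) ^ (M * (M - 3) / 2) := by
  have hcard : Fintype.card (PairIdx M) = M + M * (M - 3) / 2 := by
    have h := card_pairIdx_mul_two M
    obtain ⟨k, rfl⟩ := Nat.exists_eq_add_of_le hM
    have e1 : 3 + k - 1 = k + 2 := by omega
    have e2 : 3 + k - 3 = k := by omega
    rw [e1] at h
    rw [e2]
    have : (3 + k) * (k + 2) = (3 + k) * k + (3 + k) * 2 := by ring
    omega
  have : Nonempty (Fin M) := ⟨⟨0, by omega⟩⟩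
  have hones : (Matrix.of fun _ _ => (1 : ℝ)) * (Matrix.of fun _ _ => (1 : ℝ)) =
      (M : ℝ) • (Matrix.of fun _ _ => (1 : ℝ) : Matrix (Fin M) (Fin M) ℝ) := by
    ext; simp [Matrix.mul_apply]
  have hK : (α - 2 * β + γ) • (1 : Matrix (Fin M) (Fin M) ℝ) +
      ((β - γ) • 1 + (γ / 4) • Matrix.of fun _ _ => (1 : ℝ)) *
        (((M : ℝ) - 2) • 1 + Matrix.of fun _ _ => (1 : ℝ)) =
      (α + ((M : ℝ) - 4) * β - ((M : ℝ) - 3) * γ) • 1 +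
        (β - γ + γ / 4 * (2 * M - 2)) • Matrix.of fun _ _ => (1 : ℝ) := by
    simp only [Matrix.mul_add, Matrix.add_mul, Matrix.mul_smul, Matrix.smul_mul, Matrix.mul_one,
      Matrix.one_mul, hones]
    module
  rw [deltaMat_eq, Matrix.det_smul_one_add_mul_comm _ _ _ (by simp [hcard]), Matrix.mul_assoc,
    transpose_mul_pairIncidence, hK, Matrix.det_smul_one_add_smul_of_one, hcard, Fintype.card_fin,
    Nat.add_sub_cancel_left]
  ring
end
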